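/- Let P ⊆ A be a finite-index inclusion of unital C*-algebras with the Rohlin property. If A has topological stable rank one (the invertible elements are dense in A), then P has topological stable rank one. -/

import Mathlib

/-- A conditional expectation from a unital C*-algebra `A` onto a C*-subalgebra `P`. -/
structure IsCondExp {A : Type*} [NormedRing A] [StarRing A] [CStarRing A]
    [NormedAlgebra ℂ A] [CompleteSpace A] [StarModule ℂ A] [PartialOrder A]
    [StarOrderedRing A] (P : StarSubalgebra ℂ A) (E : A → A) : Prop where
  map_add : ∀ x y : A, E (x + y) = E x + E y
  map_smul : ∀ (c : ℂ) (x : A), E (c • x) = c • E x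
  mem : ∀ x : A, E x ∈ P
  fix : ∀ x ∈ P, E x = x
  bimod : ∀ p ∈ P, ∀ q ∈ P, ∀ x : A, E (p * x * q) = p * E x * q
  star_map : ∀ x : A, E (star x) = star (E x)
  pos : ∀ x : A, 0 ≤ E (star x * x)

/-- A quasi-basis `{(u i, v i)}` for a conditional expectation `E`. -/
def IsQuasiBasis {A : Type*} [Ring A] (E : A → A) {n : ℕ} (u v : Fin n → A) : Prop :=
  ∀ a : A, (a = ∑ i, u i * E (v i * a)) ∧ (a = ∑ i, E (a * u i) * v i)

/-- A sequence `(a n)` in a normed space is bounded. -/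
def IsBddSeq {A : Type*} [Norm A] (a : ℕ → A) : Prop := ∃ C : ℝ, ∀ n, ‖a n‖ ≤ C

/-- Data exhibiting the algebra `Ainf` as the quotient `A^∞ = ℓ^∞(ℕ, A)/c₀(A)` of
bounded sequences in `A` modulo null sequences; `q` is the quotient map (its values
on unbounded sequences are irrelevant). -/
structure SeqAlg (A : Type*) [NormedRing A] [StarRing A] [NormedAlgebra ℂ A]
    (Ainf : Type*) [Ring Ainf] [StarRing Ainf] [Algebra ℂ Ainf] where
  q : (ℕ → A) → Ainf
  surj : ∀ z : Ainf, ∃ a : ℕ → A, IsBddSeq a ∧ q a = z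
  q_add : ∀ a b : ℕ → A, IsBddSeq a → IsBddSeq b → q (a + b) = q a + q b
  q_mul : ∀ a b : ℕ → A, IsBddSeq a → IsBddSeq b → q (a * b) = q a * q b
  q_smul : ∀ (c : ℂ) (a : ℕ → A), IsBddSeq a → q (c • a) = c • q a
  q_star : ∀ a : ℕ → A, IsBddSeq a → q (star a) = star (q a)
  q_one : q 1 = 1
  q_eq_zero_iff : ∀ a : ℕ → A, IsBddSeq a →
    (q a = 0 ↔ Filter.Tendsto (fun n => ‖a n‖) Filter.atTop (nhds 0))

/-- The canonical embedding of `A` into `Ainf` as (classes of) constant sequences. -/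
def SeqAlg.incl {A : Type*} [NormedRing A] [StarRing A] [NormedAlgebra ℂ A]
    {Ainf : Type*} [Ring Ainf] [StarRing Ainf] [Algebra ℂ Ainf]
    (S : SeqAlg A Ainf) (x : A) : Ainf := S.q fun _ => x

/-- The hypotheses that `P ⊆ A` is an inclusion of unital C*-algebras with a
conditional expectation `E : A → P` of finite Watatani index (witnessed by a
quasi-basis with index sum `ind`, a central positive invertible element), having the
Rohlin property: there is a projection `e ∈ A_∞ = A^∞ ∩ A'` with
`E^∞(e) = (Index E)⁻¹ · 1` such that `x ↦ x e` is injective on `A`.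
Here `Ainf` plays the role of `A^∞ = ℓ^∞(ℕ,A)/c₀(A)` via `S : SeqAlg A Ainf`, and
`Einf` is the coordinatewise extension `E^∞`. -/
structure RohlinInclusion {A : Type*} [NormedRing A] [StarRing A] [CStarRing A]
    [NormedAlgebra ℂ A] [CompleteSpace A] [StarModule ℂ A] [PartialOrder A]
    [StarOrderedRing A] (P : StarSubalgebra ℂ A) (E : A → A)
    {Ainf : Type*} [Ring Ainf] [StarRing Ainf] [Algebra ℂ Ainf]
    (S : SeqAlg A Ainf) (Einf : Ainf → Ainf) where
  condExp : IsCondExp P E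
  -- finite index witnessed by a quasi-basis
  ind : A
  indInv : A
  quasiBasis : ∃ (n : ℕ) (u v : Fin n → A), IsQuasiBasis E u v ∧ ∑ i, u i * v i = ind
  ind_mem : ind ∈ P
  ind_central : ∀ a : A, Commute ind a
  ind_pos : 0 ≤ ind
  ind_mul_inv : ind * indInv = 1
  inv_mul_ind : indInv * ind = 1
  -- `E^∞` extends `E` coordinatewise
  Einf_compat : ∀ a : ℕ → A, IsBddSeq a → Einf (S.q a) = S.q fun n => E (a n)
  -- the Rohlin projection
  e : Ainf
  e_idem : e * e = e
  e_star : star e = e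
  e_comm : ∀ x : A, Commute e (S.incl x)
  e_exp : Einf e = S.incl indInv
  e_inj : ∀ x : A, S.incl x * e = 0 → x = 0

open Filter Topology

section ConditionalExpectation

variable {A : Type*} [CStarAlgebra A] [PartialOrder A] [StarOrderedRing A]
  {P : StarSubalgebra ℂ A} {E : A → A}

theorem IsCondExp.exists_norm_le (hE : IsCondExp P E) :
    ∃ C : ℝ, 0 ≤ C ∧ ∀ x, ‖E x‖ ≤ C * ‖x‖ := by
  let L : A →ₗ[ℂ] A := { toFun := E, map_add' := hE.map_add, map_smul' := hE.map_smul }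
  have hL : ∀ x, 0 ≤ x → 0 ≤ L x := by
    intro x hx
    obtain ⟨y, rfl⟩ := CStarAlgebra.nonneg_iff_eq_star_mul_self.mp hx
    exact hE.pos y
  obtain ⟨C, hC⟩ := PositiveLinearMap.exists_norm_apply_le (PositiveLinearMap.mk₀ L hL)
  exact ⟨C, C.2, hC⟩

theorem IsCondExp.map_sub (hE : IsCondExp P E) (x y : A) : E (x - y) = E x - E y := by
  have := hE.map_add (x - y) y
  rw [sub_add_cancel] at this
  exact eq_sub_of_add_eq this.symm

theorem IsCondExp.map_sum (hE : IsCondExp P E) {ι : Type*} (s : Finset ι) (f : ι → A) :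
    E (∑ i ∈ s, f i) = ∑ i ∈ s, E (f i) :=
  _root_.map_sum (AddMonoidHom.mk' E hE.map_add) f s

theorem IsCondExp.map_mem_mul (hE : IsCondExp P E) {p : A} (hp : p ∈ P) (x : A) :
    E (p * x) = p * E x := by
  simpa using hE.bimod p hp 1 P.one_mem x

theorem IsCondExp.isClosed (hE : IsCondExp P E) : IsClosed (P : Set A) := by
  obtain ⟨C, -, hC⟩ := hE.exists_norm_le
  have hcont : Continuous E := by
    refine (LipschitzWith.of_dist_le' (K := C) fun x y => ?_).continuous
    rw [dist_eq_norm, dist_eq_norm, ← hE.map_sub]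
    exact hC _
  have : (P : Set A) = {x | E x = x} :=
    Set.ext fun x => ⟨hE.fix x, fun h => by
      have h' : E x = x := h
      rw [← h']
      exact hE.mem x⟩
  rw [this]
  exact isClosed_eq hcont continuous_id

/-- For self-adjoint `x`, compressing by `s = x⁻ = star r * r` yields a negative element, and
`x` is positive once `s` vanishes. -/
theorem IsSelfAdjoint.exists_compression_eq_neg {B : Type*} [CStarAlgebra B] {x : B}
    (hx : IsSelfAdjoint x) :
    ∃ s r : B, star s = s ∧ s = star r * r ∧ star s * x * s = -(star (r * s) * (r * s)) ∧
      (s = 0 → ∃ t : B, x = star t * t) := by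
  let _ := CStarAlgebra.spectralOrder B
  have := CStarAlgebra.spectralOrderedRing B
  obtain ⟨r, hr⟩ := CStarAlgebra.nonneg_iff_eq_star_mul_self.mp (CFC.negPart_nonneg x)
  have hs : star x⁻ = x⁻ := IsSelfAdjoint.of_nonneg (CFC.negPart_nonneg x)
  refine ⟨x⁻, r, hs, hr, ?_, fun h => CStarAlgebra.nonneg_iff_eq_star_mul_self.mp
    (CStarAlgebra.nonneg_iff_isSelfAdjoint_and_negPart_eq_zero.mpr ⟨hx, h⟩)⟩
  have h : x⁻ * x = -(x⁻ * x⁻) := by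
    have h' : x⁻ * (x⁺ - x⁻) = -(x⁻ * x⁻) := by
      rw [mul_sub, CFC.negPart_mul_posPart, zero_sub]
    rwa [CFC.posPart_sub_negPart x hx] at h'
  rw [star_mul, hs, h, neg_mul, mul_assoc x⁻ (star r), ← mul_assoc (star r), ← hr, mul_assoc]

/-- A self-adjoint matrix over a C*-algebra `B ⊆ A` whose associated quadratic form is positive
factors as `star R * R`. -/
theorem CStarMatrix.exists_star_mul_self_of_forall_nonneg {B : Type*} [CStarAlgebra B]
    [PartialOrder B] [StarOrderedRing B] (φ : B →⋆ₐ[ℂ] A) (hφ : Function.Injective φ)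
    {n : Type*} [Fintype n] [DecidableEq n] (M : CStarMatrix n n B) (hM : IsSelfAdjoint M)
    (hpos : ∀ c : n → B, 0 ≤ φ (∑ i, ∑ j, star (c i) * M i j * c j)) :
    ∃ R : CStarMatrix n n B, M = star R * R := by
  obtain ⟨S, R, hS, hSR, hcube, hM0⟩ := hM.exists_compression_eq_neg
  refine hM0 ?_
  have hRS : R * S = 0 := by
    ext i k
    have h1 := hpos fun j => S j k
    have h2 : ∑ i, ∑ j, star (S i k) * M i j * S j k =
        -∑ i, star ((R * S) i k) * (R * S) i k := by
      have := congrFun (congrFun hcube k) k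
      rw [CStarMatrix.neg_apply, CStarMatrix.mul_apply, CStarMatrix.mul_apply] at this
      simp_rw [CStarMatrix.mul_apply (M := star S), CStarMatrix.star_apply, Finset.sum_mul] at this
      rwa [Finset.sum_comm] at this
    rw [h2, map_neg, map_sum, Left.nonneg_neg_iff] at h1
    have hnn : ∀ i ∈ Finset.univ, 0 ≤ φ (star ((R * S) i k) * (R * S) i k) := fun i _ => by
      rw [map_mul, map_star]
      exact star_mul_self_nonneg _
    have h3 := (Finset.sum_eq_zero_iff_of_nonneg hnn).mp (le_antisymm h1 (Finset.sum_nonneg hnn))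
      i (Finset.mem_univ i)
    exact (CStarRing.star_mul_self_eq_zero_iff _).mp ((map_eq_zero_iff φ hφ).mp h3)
  refine (CStarRing.star_mul_self_eq_zero_iff S).mp ?_
  rw [hS]
  nth_rewrite 1 [hSR]
  rw [mul_assoc, hRS, mul_zero]

/-- A quasi-basis can be replaced by one of the form `(w, star w)` with the same index. -/
theorem IsQuasiBasis.exists_self_dual (hE : IsCondExp P E) {n : ℕ} {u v : Fin n → A}
    (h : IsQuasiBasis E u v) (hs : IsSelfAdjoint (∑ i, u i * v i)) :
    ∃ w : Fin n → A, (∀ x, ∑ l, w l * E (star (w l) * x) = x) ∧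
      ∑ l, w l * star (w l) = ∑ i, u i * v i := by
  have : IsClosed (P : Set A) := hE.isClosed
  let _ := CStarAlgebra.spectralOrder P
  have := CStarAlgebra.spectralOrderedRing P
  let M : CStarMatrix (Fin n) (Fin n) P :=
    CStarMatrix.ofMatrix (.of fun i j => ⟨E (v i * star (v j)), hE.mem _⟩)
  have hMij : ∀ i j, (M i j : A) = E (v i * star (v j)) := fun _ _ => rfl
  have hM : IsSelfAdjoint M := by
    ext i j
    rw [CStarMatrix.star_apply, StarMemClass.coe_star, hMij, hMij, ← hE.star_map, star_mul,
      star_star]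
  have hpos : ∀ c : Fin n → P, 0 ≤ P.subtype (∑ i, ∑ j, star (c i) * M i j * c j) := by
    intro c
    have hc : P.subtype (∑ i, ∑ j, star (c i) * M i j * c j) =
        E (star (∑ j, star (v j) * (c j : A)) * ∑ j, star (v j) * (c j : A)) := by
      simp only [star_sum, Finset.sum_mul_sum, hE.map_sum, _root_.map_sum]
      refine Finset.sum_congr rfl fun i _ => Finset.sum_congr rfl fun j _ => ?_
      rw [star_mul, star_star, mul_assoc (star (c i : A)), ← mul_assoc (v i), ← mul_assoc,
        hE.bimod _ (star_mem (c i).2) _ (c j).2, ← hMij]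
      rfl
    rw [hc]
    exact hE.pos _
  obtain ⟨R, hR⟩ := M.exists_star_mul_self_of_forall_nonneg P.subtype Subtype.val_injective hM hpos
  have hRM : ∀ i j, ∑ l, star (R l i : A) * (R l j : A) = E (v i * star (v j)) := by
    intro i j
    have := congrArg Subtype.val (congrFun (congrFun hR i) j)
    rw [CStarMatrix.mul_apply] at this
    simpa [CStarMatrix.star_apply, hMij] using this.symm
  have hdual : ∀ j, ∑ i, u i * E (v i * star (v j)) = star (v j) := fun j => (h _).1.symm
  have hswap : ∀ y : Fin n → A, ∑ l, (∑ i, u i * star (R l i : A)) * ∑ j, (R l j : A) * y j =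
      ∑ j, star (v j) * y j := by
    intro y
    simp_rw +singlePass [← hdual]
    simp_rw [← hRM, Finset.sum_mul_sum, Finset.sum_mul, Finset.mul_sum, Finset.sum_mul]
    rw [Finset.sum_comm_cycle]
    refine Finset.sum_congr rfl fun j _ => ?_
    rw [Finset.sum_comm]
    simp only [mul_assoc]
  refine ⟨fun l => ∑ i, u i * star (R l i : A), fun x => ?_, ?_⟩
  · have hl : ∀ l, E (star (∑ i, u i * star (R l i : A)) * x) =
        ∑ j, (R l j : A) * E (star (u j) * x) := by
      intro l
      simp only [star_sum, star_mul, star_star, Finset.sum_mul, hE.map_sum, mul_assoc]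
      exact Finset.sum_congr rfl fun j _ => hE.map_mem_mul (R l j).2 _
    simp_rw [hl, hswap]
    have := congrArg star (h (star x)).2
    simpa [star_sum, ← hE.star_map] using this.symm
  · have hl : ∀ l, star (∑ i, u i * star (R l i : A)) = ∑ j, (R l j : A) * star (u j) := by
      intro l
      simp
    simp_rw [hl, hswap]
    rw [← hs.star_eq]
    simp

end ConditionalExpectation

section BoundedSequences

variable {A : Type*} [NormedRing A]

theorem IsBddSeq.const (x : A) : IsBddSeq fun _ : ℕ => x := ⟨‖x‖, fun _ => le_rfl⟩

theorem IsBddSeq.add {a b : ℕ → A} (ha : IsBddSeq a) (hb : IsBddSeq b) : IsBddSeq (a + b) := by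
  obtain ⟨C, hC⟩ := ha
  obtain ⟨D, hD⟩ := hb
  exact ⟨C + D, fun n => (norm_add_le _ _).trans (add_le_add (hC n) (hD n))⟩

theorem IsBddSeq.mul {a b : ℕ → A} (ha : IsBddSeq a) (hb : IsBddSeq b) : IsBddSeq (a * b) := by
  obtain ⟨C, hC⟩ := ha
  obtain ⟨D, hD⟩ := hb
  exact ⟨C * D, fun n => (norm_mul_le _ _).trans
    (mul_le_mul (hC n) (hD n) (norm_nonneg _) ((norm_nonneg _).trans (hC n)))⟩

theorem IsBddSeq.star [StarRing A] [CStarRing A] {a : ℕ → A} (ha : IsBddSeq a) :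
    IsBddSeq (star a) := by
  obtain ⟨C, hC⟩ := ha
  exact ⟨C, fun n => by simpa using hC n⟩

theorem IsBddSeq.sum {ι : Type*} (s : Finset ι) {a : ι → ℕ → A} (ha : ∀ i, IsBddSeq (a i)) :
    IsBddSeq (∑ i ∈ s, a i) := by
  classical
  induction s using Finset.induction_on with
  | empty => exact IsBddSeq.const 0
  | insert i s hi ih => rw [Finset.sum_insert hi]; exact (ha i).add ih

end BoundedSequences

namespace SeqAlg

variable {A : Type*} [CStarAlgebra A] {Ainf : Type*} [Ring Ainf] [StarRing Ainf]
  [Algebra ℂ Ainf] (S : SeqAlg A Ainf)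

/-- The canonical embedding as a ring homomorphism. -/
def inclHom : A →+* Ainf where
  toFun := S.incl
  map_one' := S.q_one
  map_mul' _ _ := S.q_mul _ _ (.const _) (.const _)
  map_zero' := (S.q_eq_zero_iff _ (.const _)).mpr (by simp)
  map_add' _ _ := S.q_add _ _ (.const _) (.const _)

theorem incl_star (x : A) : S.incl (star x) = star (S.incl x) := S.q_star _ (.const _)

theorem incl_mul (x y : A) : S.incl (x * y) = S.incl x * S.incl y := S.inclHom.map_mul x y

theorem incl_sum {ι : Type*} (s : Finset ι) (f : ι → A) :
    S.incl (∑ i ∈ s, f i) = ∑ i ∈ s, S.incl (f i) := map_sum S.inclHom f s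

theorem q_sum {ι : Type*} (s : Finset ι) {a : ι → ℕ → A} (ha : ∀ i, IsBddSeq (a i)) :
    S.q (∑ i ∈ s, a i) = ∑ i ∈ s, S.q (a i) := by
  classical
  induction s using Finset.induction_on with
  | empty => exact S.inclHom.map_zero
  | insert i s hi ih =>
    rw [Finset.sum_insert hi, Finset.sum_insert hi, S.q_add _ _ (ha i) (.sum s ha), ih]

theorem tendsto_of_q_eq_one {a : ℕ → A} (ha : IsBddSeq a) (h : S.q a = 1) :
    Tendsto a atTop (𝓝 1) := by
  have hneg : IsBddSeq fun _ : ℕ => (-1 : A) := .const _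
  have h0 : S.q (a + fun _ => -1) = 0 := by
    rw [S.q_add _ _ ha hneg, h]
    change 1 + S.inclHom (-1) = 0
    simp
  have := tendsto_zero_iff_norm_tendsto_zero.mpr ((S.q_eq_zero_iff _ (ha.add hneg)).mp h0)
  simpa using this.add_const 1

theorem eq_zero_of_sum_mul_star_eq_zero [PartialOrder A] [StarOrderedRing A]
    (S : SeqAlg A Ainf) {ι : Type*} [Fintype ι] {t : ι → Ainf} (h : ∑ i, t i * star (t i) = 0) (i : ι) : t i = 0 := by
  choose a ha hq using fun i => S.surj (t i)
  have hb : ∀ i, IsBddSeq (a i * star (a i)) := fun i => (ha i).mul (ha i).star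
  have h0 : S.q (∑ i, a i * star (a i)) = 0 := by
    rw [S.q_sum _ hb, ← h]
    exact Finset.sum_congr rfl fun i _ => by
      rw [S.q_mul _ _ (ha i) (ha i).star, S.q_star _ (ha i), hq]
  rw [S.q_eq_zero_iff _ (.sum _ hb)] at h0
  have hsq : Tendsto (fun n => ‖a i n‖ ^ 2) atTop (𝓝 0) := by
    refine squeeze_zero (fun n => sq_nonneg _) (fun n => ?_) h0
    rw [sq, ← CStarRing.norm_self_mul_star, Finset.sum_apply]
    exact CStarAlgebra.norm_le_norm_of_nonneg_of_le (mul_star_self_nonneg _)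
      (Finset.single_le_sum (f := fun i => a i n * star (a i n))
        (fun j _ => mul_star_self_nonneg _) (Finset.mem_univ i))
  rw [← hq, S.q_eq_zero_iff _ (ha i)]
  simpa using hsq.sqrt

end SeqAlg

section SequenceExpectation

variable {A : Type*} [CStarAlgebra A] [PartialOrder A] [StarOrderedRing A]
  {P : StarSubalgebra ℂ A} {E : A → A} {Ainf : Type*} [Ring Ainf] [StarRing Ainf]
  [Algebra ℂ Ainf] {S : SeqAlg A Ainf} {Einf : Ainf → Ainf}

theorem IsCondExp.isBddSeq (hE : IsCondExp P E) {a : ℕ → A} (ha : IsBddSeq a) :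
    IsBddSeq fun n => E (a n) := by
  obtain ⟨C, hC, hEC⟩ := hE.exists_norm_le
  obtain ⟨D, hD⟩ := ha
  exact ⟨C * D, fun n => (hEC _).trans (mul_le_mul_of_nonneg_left (hD n) hC)⟩

namespace RohlinInclusion

theorem Einf_incl (H : RohlinInclusion P E S Einf) (x : A) :
    Einf (S.incl x) = S.incl (E x) := H.Einf_compat _ (.const x)

theorem Einf_add (H : RohlinInclusion P E S Einf) (z w : Ainf) :
    Einf (z + w) = Einf z + Einf w := by
  obtain ⟨a, ha, rfl⟩ := S.surj z
  obtain ⟨b, hb, rfl⟩ := S.surj w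
  rw [← S.q_add _ _ ha hb, H.Einf_compat _ ha, H.Einf_compat _ hb, H.Einf_compat _ (ha.add hb),
    ← S.q_add _ _ (H.condExp.isBddSeq ha) (H.condExp.isBddSeq hb)]
  exact congrArg S.q (funext fun n => H.condExp.map_add _ _)

theorem Einf_sum (H : RohlinInclusion P E S Einf) {ι : Type*} (s : Finset ι) (f : ι → Ainf) :
    Einf (∑ i ∈ s, f i) = ∑ i ∈ s, Einf (f i) :=
  map_sum (AddMonoidHom.mk' Einf H.Einf_add) f s

theorem Einf_star (H : RohlinInclusion P E S Einf) (z : Ainf) : Einf (star z) = star (Einf z) := by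
  obtain ⟨a, ha, rfl⟩ := S.surj z
  rw [← S.q_star _ ha, H.Einf_compat _ ha, H.Einf_compat _ ha.star,
    ← S.q_star _ (H.condExp.isBddSeq ha)]
  exact congrArg S.q (funext fun n => H.condExp.star_map _)

theorem Einf_Einf_mul (H : RohlinInclusion P E S Einf) (z w : Ainf) :
    Einf (Einf z * w) = Einf z * Einf w := by
  obtain ⟨a, ha, rfl⟩ := S.surj z
  obtain ⟨b, hb, rfl⟩ := S.surj w
  have ha' := H.condExp.isBddSeq ha
  rw [H.Einf_compat _ ha, H.Einf_compat _ hb, ← S.q_mul _ _ ha' hb, H.Einf_compat _ (ha'.mul hb),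
    ← S.q_mul _ _ ha' (H.condExp.isBddSeq hb)]
  exact congrArg S.q (funext fun n => H.condExp.map_mem_mul (H.condExp.mem _) _)

theorem Einf_mul_Einf (H : RohlinInclusion P E S Einf) (z w : Ainf) :
    Einf (z * Einf w) = Einf z * Einf w := by
  have := congrArg star (H.Einf_Einf_mul (star w) (star z))
  simpa only [← H.Einf_star, star_mul, star_star] using this

theorem sum_mul_Einf (H : RohlinInclusion P E S Einf) {n : ℕ} {w : Fin n → A}
    (hw : ∀ x, ∑ l, w l * E (star (w l) * x) = x)
    (z : Ainf) : ∑ l, S.incl (w l) * Einf (star (S.incl (w l)) * z) = z := by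
  obtain ⟨a, ha, rfl⟩ := S.surj z
  have hb : ∀ l, IsBddSeq ((fun _ => star (w l)) * a) := fun l => (IsBddSeq.const _).mul ha
  have hb' : ∀ l, IsBddSeq fun n => E (star (w l) * a n) := fun l => H.condExp.isBddSeq (hb l)
  have hq : ∀ l, S.incl (w l) * Einf (star (S.incl (w l)) * S.q a) =
      S.q ((fun _ => w l) * fun n => E (star (w l) * a n)) := by
    intro l
    rw [S.q_mul _ _ (.const _) (hb' l), ← S.incl_star]
    exact congrArg (S.incl (w l) * Einf ·) (S.q_mul _ _ (.const _) ha).symm |>.trans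
      (congrArg (S.incl (w l) * ·) (H.Einf_compat _ (hb l)))
  simp_rw [hq]
  rw [← S.q_sum _ fun l => (IsBddSeq.const (w l)).mul (hb' l)]
  refine congrArg S.q (funext fun n => ?_)
  simpa using hw (a n)

theorem star_incl_ind (H : RohlinInclusion P E S Einf) : star (S.incl H.ind) = S.incl H.ind := by
  rw [← S.incl_star, (IsSelfAdjoint.of_nonneg H.ind_pos).star_eq]

theorem incl_ind_mul_Einf_e (H : RohlinInclusion P E S Einf) : S.incl H.ind * Einf H.e = 1 := by
  rw [H.e_exp, ← S.incl_mul, H.ind_mul_inv]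
  exact S.q_one

/-- The identity `x e = β(x) e` with `β(x) = E^∞(x e) Index(E)`. -/
theorem incl_mul_e (H : RohlinInclusion P E S Einf) (x : A) :
    S.incl x * H.e = Einf (S.incl x * H.e) * S.incl H.ind * H.e := by
  obtain ⟨n, u, v, huv, hind⟩ := H.quasiBasis
  obtain ⟨w, hw, hww⟩ := huv.exists_self_dual H.condExp
    (hind ▸ IsSelfAdjoint.of_nonneg H.ind_pos)
  rw [hind] at hww
  set I := S.incl H.ind with hI
  set W := fun l => S.incl (w l) with hW
  set e := H.e
  have hee : e * e = e := H.e_idem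
  have hes : star e = e := H.e_star
  have hIs : star I = I := H.star_incl_ind
  have hbs : ∀ l, star (Einf (e * W l)) = Einf (star (W l) * e) := fun l => by
    rw [← H.Einf_star, star_mul, hes]
  have h1 : ∑ l, W l * star (W l) = I := by
    simp only [hW, hI, ← hww, S.incl_sum, S.incl_mul, S.incl_star]
  have h2 : ∑ l, W l * Einf (star (W l) * e) = e := H.sum_mul_Einf hw e
  have h3 : ∑ l, Einf (e * W l) * star (W l) = e := by
    have := congrArg star h2
    simpa only [star_sum, star_mul, ← hbs, star_star, hes] using this
  have h4 : ∑ l, Einf (e * W l) * Einf (star (W l) * e) = Einf e := by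
    simp_rw [← H.Einf_mul_Einf, mul_assoc]
    rw [← H.Einf_sum, ← Finset.mul_sum, h2, hee]
  have hIE : I * Einf e = 1 := H.incl_ind_mul_Einf_e
  have ht : ∀ l, (e * W l - e * I * Einf (e * W l)) * star (e * W l - e * I * Einf (e * W l)) =
      e * (W l * star (W l)) * e - e * (W l * Einf (star (W l) * e)) * I * e
        - e * I * (Einf (e * W l) * star (W l)) * e
        + e * I * (Einf (e * W l) * Einf (star (W l) * e)) * I * e := by
    intro l
    simp only [star_sub, star_mul, hes, hIs, hbs]
    noncomm_ring
  have hsum : ∑ l, (e * W l - e * I * Einf (e * W l)) *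
      star (e * W l - e * I * Einf (e * W l)) = 0 := by
    simp_rw [ht]
    rw [Finset.sum_add_distrib, Finset.sum_sub_distrib, Finset.sum_sub_distrib]
    simp_rw [← Finset.sum_mul, ← Finset.mul_sum]
    rw [h1, h2, h3, h4, hee, mul_assoc e I (Einf e), hIE, mul_one, mul_assoc (e * I), hee]
    noncomm_ring
  have hzero : ∀ l, e * W l = e * I * Einf (e * W l) := fun l =>
    sub_eq_zero.mp (S.eq_zero_of_sum_mul_star_eq_zero hsum l)
  have hleft : ∀ z, e * z = e * I * Einf (e * z) := by
    intro z
    have hz := H.sum_mul_Einf hw z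
    calc e * z = ∑ l, e * W l * Einf (star (W l) * z) := by
          conv_lhs => rw [← hz, Finset.mul_sum]
          simp only [mul_assoc, hW]
      _ = ∑ l, e * I * Einf (e * W l * Einf (star (W l) * z)) := by
          refine Finset.sum_congr rfl fun l _ => ?_
          rw [H.Einf_mul_Einf, ← mul_assoc, ← hzero]
      _ = e * I * Einf (e * z) := by
          rw [← Finset.mul_sum, ← H.Einf_sum]
          simp only [mul_assoc e, ← Finset.mul_sum]
          simp only [hW, hz]
  have := congrArg star (hleft (S.incl (star x)))
  simpa only [star_mul, hes, hIs, ← H.Einf_star, S.incl_star, star_star, mul_assoc] using this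

/-- The map `x ↦ Index(E) E^∞(x e)` preserves one-sided inverses. -/
theorem map_mul_map_eq_one (H : RohlinInclusion P E S Einf) {y z : A} (hyz : y * z = 1) :
    (S.incl H.ind * Einf (S.incl y * H.e)) * (S.incl H.ind * Einf (S.incl z * H.e)) = 1 := by
  have hI : S.incl H.ind = Einf (S.incl H.ind) := by
    rw [H.Einf_incl, H.condExp.fix _ H.ind_mem]
  have h1 : S.incl H.ind * Einf (S.incl z * H.e) = Einf (S.incl H.ind * (S.incl z * H.e)) := by
    conv_rhs => rw [hI, H.Einf_Einf_mul, ← hI]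
  have h2 : Einf (S.incl y * H.e) * (S.incl H.ind * (S.incl z * H.e)) = H.e := by
    rw [← (H.e_comm z).eq, ← mul_assoc, ← mul_assoc, ← H.incl_mul_e, mul_assoc, (H.e_comm z).eq,
      ← mul_assoc, ← S.incl_mul, hyz]
    exact (congrArg (· * H.e) S.q_one).trans (one_mul _)
  rw [h1, mul_assoc, ← H.Einf_Einf_mul, h2, H.incl_ind_mul_Einf_e]

end RohlinInclusion

end SequenceExpectation

/-- In a closed subalgebra, an element with approximate one-sided inverses is invertible. -/
theorem exists_inv_of_norm_sub_one_lt {A : Type*} [CStarAlgebra A] {P : StarSubalgebra ℂ A}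
    (hP : IsClosed (P : Set A)) {b c : A} (hb : b ∈ P) (hc : c ∈ P)
    (hbc : ‖b * c - 1‖ < 1) (hcb : ‖c * b - 1‖ < 1) : ∃ z ∈ P, b * z = 1 ∧ z * b = 1 := by
  have : CompleteSpace P := hP.completeSpace_coe
  let b' : P := ⟨b, hb⟩
  let c' : P := ⟨c, hc⟩
  have h1 : IsUnit (b' * c') := by
    simpa using isUnit_one_sub_of_norm_lt_one (x := 1 - b' * c') (by rw [norm_sub_rev]; exact hbc)
  have h2 : IsUnit (c' * b') := by
    simpa using isUnit_one_sub_of_norm_lt_one (x := 1 - c' * b') (by rw [norm_sub_rev]; exact hcb)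
  obtain ⟨r, hr⟩ := h1.exists_right_inv
  obtain ⟨l, hl⟩ := h2.exists_left_inv
  have hr' : b' * (c' * r) = 1 := by rw [← mul_assoc, hr]
  have hl' : l * c' * b' = 1 := by rw [mul_assoc, hl]
  have hz : (c' * r) * b' = 1 := by rw [← left_inv_eq_right_inv hl' hr', hl']
  exact ⟨(c' * r : P), (c' * r).2, congrArg Subtype.val hr', congrArg Subtype.val hz⟩

/-- The bundled form of the main theorem: the approximants are the terms of a representing sequence
of `β(y)`, with `y` an invertible of `A` close to `x`. -/
theorem RohlinInclusion.exists_invertible_near {A : Type*} [CStarAlgebra A] [PartialOrder A]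
    [StarOrderedRing A] {P : StarSubalgebra ℂ A} {E : A → A} {Ainf : Type*} [Ring Ainf]
    [StarRing Ainf] [Algebra ℂ Ainf] {S : SeqAlg A Ainf} {Einf : Ainf → Ainf}
    (H : RohlinInclusion P E S Einf)
    (htsrA : ∀ x : A, ∀ ε : ℝ, 0 < ε → ∃ y : A, IsUnit y ∧ ‖x - y‖ < ε)
    {x : A} (hx : x ∈ P) {ε : ℝ} (hε : 0 < ε) :
    ∃ y ∈ P, (∃ z ∈ P, y * z = 1 ∧ z * y = 1) ∧ ‖x - y‖ < ε := by
  obtain ⟨f, hf, hfe⟩ := S.surj H.e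
  obtain ⟨C, hC0, hC⟩ := H.condExp.exists_norm_le
  obtain ⟨F, hF⟩ := id hf
  have hF0 : 0 ≤ F := (norm_nonneg _).trans (hF 0)
  set K := ‖H.ind‖ * (C * F) with hK
  have hK0 : 0 ≤ K := by positivity
  obtain ⟨y, ⟨y, rfl⟩, hxy⟩ := htsrA x (ε / (2 * (K + 1))) (by positivity)
  let g : A → ℕ → A := fun a n => H.ind * E (a * f n)
  have hbdd : ∀ a, IsBddSeq fun n => E (a * f n) := fun a =>
    H.condExp.isBddSeq ((IsBddSeq.const a).mul hf)
  have hg : ∀ a, IsBddSeq (g a) := fun a => (IsBddSeq.const _).mul (hbdd a)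
  have hgq : ∀ a, S.q (g a) = S.incl H.ind * Einf (S.incl a * H.e) := by
    intro a
    have h : Einf (S.incl a * H.e) = S.q fun n => E (a * f n) := by
      rw [← hfe]
      exact (congrArg Einf (S.q_mul _ _ (.const a) hf)).symm.trans
        (H.Einf_compat _ ((IsBddSeq.const a).mul hf))
    rw [h]
    exact S.q_mul _ _ (.const _) (hbdd a)
  have hgP : ∀ a n, g a n ∈ P := fun a n => mul_mem H.ind_mem (H.condExp.mem _)
  have hmul : ∀ {a b : A}, a * b = 1 → ∀ᶠ n in atTop, ‖g a n * g b n - 1‖ < 1 := by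
    intro a b hab
    have := S.tendsto_of_q_eq_one ((hg a).mul (hg b))
      (by rw [S.q_mul _ _ (hg a) (hg b), hgq, hgq, H.map_mul_map_eq_one hab])
    simpa [dist_eq_norm] using this.eventually (Metric.ball_mem_nhds 1 one_pos)
  have hone : ∀ᶠ n in atTop, ‖x‖ * ‖g 1 n - 1‖ < ε / 2 := by
    have h1 := S.tendsto_of_q_eq_one (hg 1) (by
      rw [hgq, show S.incl 1 = 1 from S.q_one, one_mul, H.incl_ind_mul_Einf_e])
    have h2 : Tendsto (fun n => ‖x‖ * ‖g 1 n - 1‖) atTop (𝓝 0) := by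
      simpa using ((h1.sub_const 1).norm).const_mul ‖x‖
    exact h2.eventually_lt_const (half_pos hε)
  obtain ⟨n, h1, h2, h3⟩ := ((hmul y.mul_inv).and ((hmul y.inv_mul).and hone)).exists
  refine ⟨g y n, hgP _ n, exists_inv_of_norm_sub_one_lt H.condExp.isClosed (hgP _ n)
    (hgP _ n) h1 h2, ?_⟩
  have hgx : g x n = x * g 1 n := by
    simp only [g, one_mul, H.condExp.map_mem_mul hx]
    rw [← mul_assoc, (H.ind_central x).eq, mul_assoc]
  have hsub : g x n - g y n = H.ind * E ((x - y) * f n) := by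
    simp only [g, ← mul_sub, ← H.condExp.map_sub, ← sub_mul]
  have hbound : ‖g x n - g y n‖ ≤ K * ‖x - y‖ := by
    rw [hsub]
    calc ‖H.ind * E ((x - y) * f n)‖ ≤ ‖H.ind‖ * (C * (‖x - ↑y‖ * F)) := by
          refine (norm_mul_le _ _).trans ?_
          gcongr
          refine (hC _).trans ?_
          gcongr
          exact (norm_mul_le _ _).trans (by gcongr; exact hF n)
      _ = K * ‖x - y‖ := by rw [hK]; ring
  have hlt : K * ‖x - ↑y‖ ≤ ε / 2 := by
    have h5 : (K + 1) * ‖x - ↑y‖ ≤ ε / 2 := by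
      rw [lt_div_iff₀ (by positivity)] at hxy
      linarith
    nlinarith [norm_nonneg (x - (y : A))]
  calc ‖x - g y n‖ = ‖-(x * (g 1 n - 1)) + (g x n - g y n)‖ := by
        rw [hgx]; congr 1; noncomm_ring
    _ ≤ ‖x‖ * ‖g 1 n - 1‖ + ‖g x n - g y n‖ :=
        (norm_add_le _ _).trans (by rw [norm_neg]; gcongr; exact norm_mul_le _ _)
    _ < ε := by linarith

/-- let `P ⊆ A` be a finite-index inclusion of unital C*-algebras with
the Rohlin property. If `A` has topological stable rank one (the invertible elements
are dense in `A`), then `P` has topological stable rank one (the elements of `P`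
invertible in `P` are dense in `P`). -/
theorem rohlin_inclusion_stable_rank_one
    {A : Type*} [NormedRing A] [StarRing A] [CStarRing A] [NormedAlgebra ℂ A]
    [CompleteSpace A] [StarModule ℂ A] [PartialOrder A] [StarOrderedRing A]
    (P : StarSubalgebra ℂ A) (E : A → A)
    {Ainf : Type*} [Ring Ainf] [StarRing Ainf] [Algebra ℂ Ainf]
    (S : SeqAlg A Ainf) (Einf : Ainf → Ainf)
    (hRohlin : RohlinInclusion P E S Einf)
    (htsrA : ∀ x : A, ∀ ε : ℝ, 0 < ε → ∃ y : A, IsUnit y ∧ ‖x - y‖ < ε) :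
    ∀ x ∈ P, ∀ ε : ℝ, 0 < ε →
      ∃ y ∈ P, (∃ z ∈ P, y * z = 1 ∧ z * y = 1) ∧ ‖x - y‖ < ε := by
  let _ : CStarAlgebra A := { }
  exact fun x hx ε hε => hRohlin.exists_invertible_near htsrA hx hε
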